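/- arXiv:2007.12618 — 8 statements merged into one kernel-verified Lean document; each statement's English description precedes it below -/
import Mathlib

section
/- Lemma 1 (surrogate gap lemma, deterministic form): Let K ≥ 2, T ≥ 1, D > 0, η > 0 and γ ∈ [0,1]. For t = 1,…,T let ℓ_t : ℝ^{K×d} → ℝ and g_t ∈ ℝ^{K×d} satisfy ℓ_t(U) ≥ ℓ_t(W_t) + ⟨g_t, U − W_t⟩ for all U with ‖U‖ ≤ D, where W_1 = 0 and W_{t+1} = Π_D(W_t − η g_t). Let y_t, y_t⋆ ∈ {1,…,K} and a_t ∈ [0,1] be arbitrary. Then for every U with ‖U‖ ≤ D: Σ_{t=1}^T [(1 − max{a_t,γ})·1[y_t⋆ ≠ y_t] + max{a_t,γ}·(K−1)/K] ≤ Σ_{t=1}^T ℓ_t(U) + ‖U‖²/(2η) + γ·((K−1)/K)·T + Σ_{t=1}^T [(1 − a_t)·1[y_t⋆ ≠ y_t] + a_t·(K−1)/K − ℓ_t(W_t) + (η/2)‖g_t‖²]. -/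
open scoped RealInnerProductSpace BigOperators

/-- Frobenius norm of a `K × d` matrix given by its rows. -/
noncomputable def frob {K d : ℕ} (W : Fin K → EuclideanSpace ℝ (Fin d)) : ℝ :=
  Real.sqrt (∑ k, ‖W k‖ ^ 2)

/-- Frobenius (trace) inner product of two `K × d` matrices given by their rows. -/
noncomputable def finner {K d : ℕ} (W U : Fin K → EuclideanSpace ℝ (Fin d)) : ℝ :=
  ∑ k, ⟪W k, U k⟫

/-- Euclidean (Frobenius) projection onto the ball of radius `D`. -/
noncomputable def projM {K d : ℕ} (D : ℝ) (V : Fin K → EuclideanSpace ℝ (Fin d)) :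
    Fin K → EuclideanSpace ℝ (Fin d) :=
  if frob V ≤ D then V else fun k => (D / frob V) • V k

theorem frob_sq_aux {K d : ℕ} (W : Fin K → EuclideanSpace ℝ (Fin d)) :
    frob W ^ 2 = ∑ k, ‖W k‖ ^ 2 := by
  unfold frob
  exact Real.sq_sqrt (Finset.sum_nonneg fun k _ => sq_nonneg _)

theorem finner_le_aux {K d : ℕ} (V U : Fin K → EuclideanSpace ℝ (Fin d)) :
    finner V U ≤ frob V * frob U := by
  unfold finner frob
  calc ∑ k, ⟪V k, U k⟫ ≤ ∑ k, ‖V k‖ * ‖U k‖ :=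
        Finset.sum_le_sum fun k _ => real_inner_le_norm _ _
    _ ≤ _ := Real.sum_mul_le_sqrt_mul_sqrt _ _ _

theorem expand_aux {K d : ℕ} (s : ℝ) (V U : Fin K → EuclideanSpace ℝ (Fin d)) :
    ∑ k, ‖s • V k - U k‖ ^ 2 = s ^ 2 * frob V ^ 2 - 2 * s * finner V U + frob U ^ 2 := by
  rw [frob_sq_aux, frob_sq_aux, finner, Finset.mul_sum, Finset.mul_sum,
    ← Finset.sum_sub_distrib, ← Finset.sum_add_distrib]
  refine Finset.sum_congr rfl fun k _ => ?_
  rw [norm_sub_sq_real, norm_smul, mul_pow, real_inner_smul_left, Real.norm_eq_abs, sq_abs]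
  ring

theorem proj_aux {K d : ℕ} (D : ℝ) (hD : 0 < D) (V U : Fin K → EuclideanSpace ℝ (Fin d))
    (hU : frob U ≤ D) :
    ∑ k, ‖projM D V k - U k‖ ^ 2 ≤ ∑ k, ‖V k - U k‖ ^ 2 := by
  unfold projM
  split_ifs with h
  · exact le_rfl
  · push Not at h
    have h1 := expand_aux 1 V U
    simp only [one_smul] at h1
    rw [h1, expand_aux]
    have hn : 0 < frob V := hD.trans h
    have hp : finner V U ≤ frob V * D :=
      (finner_le_aux V U).trans (mul_le_mul_of_nonneg_left hU hn.le)
    obtain ⟨s, hs⟩ : ∃ s, s = D / frob V := ⟨_, rfl⟩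
    have hsn : s * frob V = D := by rw [hs]; field_simp
    have hs1 : s ≤ 1 := by rw [hs]; exact (div_le_one hn).2 h.le
    rw [← hs]
    have e : s ^ 2 * frob V ^ 2 = D ^ 2 := by rw [← hsn]; ring
    have e2 : (1 - s) * (frob V * D) = frob V * D - D ^ 2 := by
      rw [sub_mul, ← mul_assoc s, hsn]; ring
    have := mul_le_mul_of_nonneg_left hp (sub_nonneg.2 hs1)
    nlinarith [sq_nonneg (frob V - D)]

theorem step_aux {K d : ℕ} (D η : ℝ) (hD : 0 < D) (W G U : Fin K → EuclideanSpace ℝ (Fin d))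
    (hU : frob U ≤ D) :
    ∑ k, ‖projM D (fun k => W k - η • G k) k - U k‖ ^ 2 ≤
      ∑ k, ‖W k - U k‖ ^ 2 + 2 * η * finner G (fun k => U k - W k) + η ^ 2 * frob G ^ 2 := by
  refine (proj_aux D hD _ U hU).trans (le_of_eq ?_)
  rw [frob_sq_aux, finner, Finset.mul_sum, Finset.mul_sum,
    ← Finset.sum_add_distrib, ← Finset.sum_add_distrib]
  refine Finset.sum_congr rfl fun k _ => ?_
  have e : W k - η • G k - U k = (W k - U k) - η • G k := by abel
  have e2 : U k - W k = -(W k - U k) := by abel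
  rw [e, e2, norm_sub_sq_real, norm_smul, mul_pow, real_inner_smul_right, Real.norm_eq_abs,
    sq_abs, inner_neg_right, real_inner_comm (W k - U k) (G k)]
  ring

/-- Lemma 1 (surrogate gap lemma, deterministic form). -/
theorem gaptron_surrogate_gap_lemma (K d T : ℕ) (hK : 2 ≤ K) (hd : 1 ≤ d) (hT : 1 ≤ T)
    (D η γ : ℝ) (hD : 0 < D) (hη : 0 < η) (hγ0 : 0 ≤ γ) (hγ1 : γ ≤ 1)
    (ℓ : Fin T → (Fin K → EuclideanSpace ℝ (Fin d)) → ℝ)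
    (g : Fin T → Fin K → EuclideanSpace ℝ (Fin d))
    (W : ℕ → Fin K → EuclideanSpace ℝ (Fin d))
    (hW0 : W 0 = 0)
    (hWsucc : ∀ t : Fin T, W (t.1 + 1) = projM D (fun k => W t.1 k - η • g t k))
    (hsub : ∀ t : Fin T, ∀ U : Fin K → EuclideanSpace ℝ (Fin d), frob U ≤ D →
      ℓ t (W t.1) + finner (g t) (fun k => U k - W t.1 k) ≤ ℓ t U)
    (y ystar : Fin T → Fin K)
    (a : Fin T → ℝ) (ha0 : ∀ t, 0 ≤ a t) (ha1 : ∀ t, a t ≤ 1)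
    (U : Fin K → EuclideanSpace ℝ (Fin d)) (hU : frob U ≤ D) :
    ∑ t : Fin T, ((1 - max (a t) γ) * (if ystar t ≠ y t then (1 : ℝ) else 0)
        + max (a t) γ * (((K : ℝ) - 1) / K))
      ≤ ∑ t : Fin T, ℓ t U + frob U ^ 2 / (2 * η) + γ * (((K : ℝ) - 1) / K) * T
        + ∑ t : Fin T, ((1 - a t) * (if ystar t ≠ y t then (1 : ℝ) else 0)
            + a t * (((K : ℝ) - 1) / K) - ℓ t (W t.1) + (η / 2) * frob (g t) ^ 2) := by
  have hK0 : (2 : ℝ) ≤ K := by exact_mod_cast hK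
  obtain ⟨c, hc⟩ : ∃ c, c = ((K : ℝ) - 1) / K := ⟨_, rfl⟩
  have hc0 : 0 ≤ c := by rw [hc]; exact div_nonneg (by linarith) (by linarith)
  have hc1 : c ≤ 1 := by rw [hc]; exact (div_le_one (by linarith)).2 (by linarith)
  rw [← hc]
  set f : ℕ → ℝ := fun t => ∑ k, ‖W t k - U k‖ ^ 2 with hf
  have htel : ∑ t : Fin T, (f (t.1 + 1) - f t.1) = f T - f 0 := by
    rw [Fin.sum_univ_eq_sum_range (fun t => f (t + 1) - f t) T, Finset.sum_range_sub]
  have hfT : 0 ≤ f T := Finset.sum_nonneg fun k _ => sq_nonneg _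
  have hf0 : f 0 = frob U ^ 2 := by simp [hf, hW0, frob_sq_aux]
  have hround : ∀ t : Fin T,
      ((1 - max (a t) γ) * (if ystar t ≠ y t then (1 : ℝ) else 0) + max (a t) γ * c)
      ≤ ℓ t U + γ * c + ((1 - a t) * (if ystar t ≠ y t then (1 : ℝ) else 0)
            + a t * c - ℓ t (W t.1) + (η / 2) * frob (g t) ^ 2)
        - (f (t.1 + 1) - f t.1) / (2 * η) := by
    intro t
    have h1 := hsub t U hU
    have h2 := step_aux D η hD (W t.1) (g t) U hU
    rw [← hWsucc t] at h2
    have h3 : (f (t.1 + 1) - f t.1) / (2 * η) ≤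
        finner (g t) (fun k => U k - W t.1 k) + (η / 2) * frob (g t) ^ 2 := by
      rw [div_le_iff₀ (by linarith)]
      simp only [hf]
      nlinarith
    have hm1 : a t ≤ max (a t) γ := le_max_left _ _
    have hm2 : max (a t) γ ≤ a t + γ := max_le (by linarith) (by linarith [ha0 t])
    have h4 : (1 - max (a t) γ) * (if ystar t ≠ y t then (1 : ℝ) else 0) + max (a t) γ * c
        ≤ (1 - a t) * (if ystar t ≠ y t then (1 : ℝ) else 0) + a t * c + γ * c := by
      split_ifs
      · nlinarith [mul_nonneg (sub_nonneg.2 hm1) (sub_nonneg.2 hc1), mul_nonneg hγ0 hc0]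
      · nlinarith [mul_le_mul_of_nonneg_right hm2 hc0]
    linarith
  refine (Finset.sum_le_sum fun t _ => hround t).trans ?_
  rw [Finset.sum_sub_distrib, Finset.sum_add_distrib, Finset.sum_add_distrib, ← Finset.sum_div,
    htel, hf0, Finset.sum_const, Finset.card_univ, Fintype.card_fin, nsmul_eq_mul, sub_div]
  have : 0 ≤ f T / (2 * η) := div_nonneg hfT (by linarith)
  linarith
end

section
/- Per-round surrogate gap bound for the logistic loss: Let K ≥ 2, d ≥ 1, X > 0 and η = ln(2)/(2KX²). Let W ∈ ℝ^{K×d}, x ∈ ℝ^d with ‖x‖ ≤ X, and y ∈ {1,…,K}. Set p̃(k) = σ(W,x,k), p⋆ = max_k p̃(k), let y⋆ be any label maximizing p̃, let a = 1 − p⋆ if p⋆ ≥ 1/2 and a = 1 otherwise, and let g = (1/ln 2)(p̃ − e_y) ⊗ x. Then (1 − a)·1[y⋆ ≠ y] + a·(K−1)/K + log₂ p̃(y) + (η/2)‖g‖² ≤ 0. -/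
open scoped RealInnerProductSpace BigOperators

/-- Softmax probabilities `σ(W, x, k)`. -/
noncomputable def softmax {K d : ℕ} (W : Fin K → EuclideanSpace ℝ (Fin d))
    (x : EuclideanSpace ℝ (Fin d)) (k : Fin K) : ℝ :=
  Real.exp ⟪W k, x⟫ / ∑ j, Real.exp ⟪W j, x⟫

theorem sum_sq_aux {K : ℕ} (p : Fin K → ℝ) (hp : ∀ k, 0 ≤ p k) (hs : ∑ k, p k = 1) (y : Fin K) :
    ∑ k, (p k - if k = y then 1 else 0) ^ 2 ≤ 2 * (1 - p y) ^ 2 := by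
  rw [← Finset.add_sum_erase _ _ (Finset.mem_univ y)] at hs ⊢
  have h1 : ∑ k ∈ Finset.univ.erase y, (p k - if k = y then 1 else 0) ^ 2
      = ∑ k ∈ Finset.univ.erase y, p k ^ 2 := by
    apply Finset.sum_congr rfl
    intro k hk
    rw [if_neg (Finset.ne_of_mem_erase hk), sub_zero]
  have h2 : ∑ k ∈ Finset.univ.erase y, p k ^ 2 ≤ (∑ k ∈ Finset.univ.erase y, p k) ^ 2 :=
    Finset.sum_sq_le_sq_sum_of_nonneg (fun k _ => hp k)
  have h3 : ∑ k ∈ Finset.univ.erase y, p k = 1 - p y := by linarith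
  rw [h1]
  rw [h3] at h2
  simp only [if_true]
  nlinarith

/-- Per-round surrogate gap bound for the logistic loss. -/
theorem gaptron_logistic_gap (K d : ℕ) (hK : 2 ≤ K) (hd : 1 ≤ d)
    (X : ℝ) (hX : 0 < X)
    (η : ℝ) (hη : η = Real.log 2 / (2 * K * X ^ 2))
    (W : Fin K → EuclideanSpace ℝ (Fin d))
    (x : EuclideanSpace ℝ (Fin d)) (hx : ‖x‖ ≤ X)
    (y ystar : Fin K)
    (hystar : ∀ k, softmax W x k ≤ softmax W x ystar)
    (pstar : ℝ) (hpstar : pstar = ⨆ k, softmax W x k)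
    (a : ℝ) (ha : a = if (1 : ℝ) / 2 ≤ pstar then 1 - pstar else 1)
    (g : Fin K → EuclideanSpace ℝ (Fin d))
    (hg : g = fun k => ((1 / Real.log 2) * (softmax W x k - if k = y then 1 else 0)) • x) :
    (1 - a) * (if ystar ≠ y then (1 : ℝ) else 0) + a * (((K : ℝ) - 1) / K)
      + Real.logb 2 (softmax W x y) + (η / 2) * frob g ^ 2 ≤ 0 := by
  have hK2 : (2 : ℝ) ≤ K := by exact_mod_cast hK
  have hK0 : (0 : ℝ) < K := by linarith
  have hne : Nonempty (Fin K) := ⟨y⟩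
  have hl := Real.log_two_gt_d9
  have hl2 := Real.log_two_lt_d9
  have hL0 : 0 < Real.log 2 := by linarith
  have hZ : 0 < ∑ j, Real.exp ⟪W j, x⟫ :=
    Finset.sum_pos (fun j _ => Real.exp_pos _) Finset.univ_nonempty
  have hpos : ∀ k, 0 < softmax W x k := fun k => div_pos (Real.exp_pos _) hZ
  have hsum : ∑ k, softmax W x k = 1 := by
    unfold softmax
    rw [← Finset.sum_div, div_self hZ.ne']
  have hps : pstar = softmax W x ystar := by
    rw [hpstar]
    exact le_antisymm (ciSup_le hystar) (le_ciSup (Set.finite_range _).bddAbove ystar)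
  have hS := sum_sq_aux (softmax W x) (fun k => (hpos k).le) hsum y
  have hS0 : 0 ≤ ∑ k, (softmax W x k - if k = y then 1 else 0) ^ 2 :=
    Finset.sum_nonneg (fun k _ => sq_nonneg _)
  have hfr : frob g ^ 2 = (1 / Real.log 2) ^ 2 *
      (∑ k, (softmax W x k - if k = y then 1 else 0) ^ 2) * ‖x‖ ^ 2 := by
    unfold frob
    rw [Real.sq_sqrt (Finset.sum_nonneg (fun k _ => sq_nonneg _)), hg, Finset.mul_sum,
      Finset.sum_mul]
    apply Finset.sum_congr rfl
    intro k _
    rw [norm_smul, mul_pow, Real.norm_eq_abs, sq_abs, mul_pow]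
  have hy1 : softmax W x y ≤ 1 := by
    rw [← hsum]
    exact Finset.single_le_sum (fun k _ => (hpos k).le) (Finset.mem_univ y)
  have hyp : ystar ≠ y → softmax W x y + softmax W x ystar ≤ 1 := by
    intro h
    rw [← hsum, ← Finset.sum_pair h.symm]
    exact Finset.sum_le_sum_of_subset_of_nonneg (Finset.subset_univ _) (fun k _ _ => (hpos k).le)
  have hp0 := hpos y
  have hymax := hystar y
  set S := ∑ k, (softmax W x k - if k = y then 1 else 0) ^ 2
  have hquad : (η / 2) * frob g ^ 2 ≤ (1 - softmax W x y) ^ 2 / (2 * K * Real.log 2) := by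
    have hx2 : ‖x‖ ^ 2 ≤ X ^ 2 := pow_le_pow_left₀ (norm_nonneg _) hx 2
    have h1 : S * ‖x‖ ^ 2 ≤ 2 * (1 - softmax W x y) ^ 2 * X ^ 2 :=
      mul_le_mul hS hx2 (sq_nonneg _) (by positivity)
    have e1 : (η / 2) * frob g ^ 2 = (S * ‖x‖ ^ 2) / (4 * K * Real.log 2 * X ^ 2) := by
      rw [hfr, hη]
      field_simp
      try ring
    have e2 : (1 - softmax W x y) ^ 2 / (2 * K * Real.log 2)
        = (2 * (1 - softmax W x y) ^ 2 * X ^ 2) / (4 * K * Real.log 2 * X ^ 2) := by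
      field_simp
      try ring
    rw [e1, e2]
    gcongr
  rw [← hps] at hyp hymax
  have hlb : Real.logb 2 (softmax W x y) = Real.log (softmax W x y) / Real.log 2 := rfl
  rw [hlb]
  have hyeq : ystar = y → softmax W x y = pstar := by
    rintro rfl
    exact hps.symm
  generalize softmax W x y = p at *
  generalize (η / 2) * frob g ^ 2 = Q at *
  have hlog1 : Real.log p ≤ p - 1 := Real.log_le_sub_one_of_pos hp0
  have hlog2 : Real.log p ≤ 2 * p - 1 - Real.log 2 := by
    have h := Real.log_le_sub_one_of_pos (show 0 < 2 * p by linarith)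
    rw [Real.log_mul (by norm_num) hp0.ne'] at h
    linarith
  have hq : ∀ A : ℝ, 2 * K * Real.log 2 * A + 2 * K * Real.log p + (1 - p) ^ 2 ≤ 0 →
      A + Real.log p / Real.log 2 + Q ≤ 0 := by
    intro A hA
    have e : A + Real.log p / Real.log 2 + (1 - p) ^ 2 / (2 * K * Real.log 2)
        = (2 * K * Real.log 2 * A + 2 * K * Real.log p + (1 - p) ^ 2) / (2 * K * Real.log 2) := by
      field_simp
    have := div_nonpos_of_nonpos_of_nonneg hA (show 0 ≤ 2 * K * Real.log 2 by positivity)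
    linarith
  apply hq
  have e : ∀ B C : ℝ, 2 * K * Real.log 2 * (B + C * ((K - 1) / K))
      = 2 * Real.log 2 * (K * B + C * (K - 1)) := by
    intro B C
    field_simp
  rw [e]
  generalize Real.log 2 = L at *
  generalize Real.log p = l at *
  generalize (K : ℝ) = k at *
  split_ifs at ha with h1
  · by_cases h2 : ystar = y
    · have := hyeq h2
      subst this
      simp only [h2, ne_eq, not_true_eq_false, if_false, ha]
      have h3 : k * l ≤ k * (p - 1) := mul_le_mul_of_nonneg_left hlog1 hK0.le
      have h4 : 0 ≤ (1 - L) * ((1 - p) * (k - 1)) :=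
        mul_nonneg (by linarith) (mul_nonneg (by linarith) (by linarith))
      nlinarith
    · have h5 := hyp h2
      simp only [h2, ne_eq, not_false_eq_true, if_true, ha]
      have h3 : k * l ≤ k * (2 * p - 1 - L) := mul_le_mul_of_nonneg_left hlog2 hK0.le
      have h4 : L * p ≤ L * (1 - pstar) := mul_le_mul_of_nonneg_left (by linarith) hL0.le
      have h6 : 0 ≤ (k - 2) * (1 - 2 * p) := mul_nonneg (by linarith) (by linarith)
      have h7 : 1 / 2 * p ≤ L * p := mul_le_mul_of_nonneg_right (by linarith) hp0.le
      nlinarith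
  · have hp2 : p < 1 / 2 := by linarith
    have h3 : k * l ≤ k * (2 * p - 1 - L) := mul_le_mul_of_nonneg_left hlog2 hK0.le
    have h6 : 0 ≤ k * (1 - 2 * p) := mul_nonneg (by linarith) (by linarith)
    subst ha
    nlinarith
end

section
/- Per-round surrogate gap bound for the multiclass hinge loss: Let K ≥ 2, d ≥ 1, X > 0, β = 1/K and η = (1−β)/(KX²). Let W ∈ ℝ^{K×d}, x ∈ ℝ^d with ‖x‖ ≤ X, and y ∈ {1,…,K}. Let y⋆ be any label maximizing k ↦ ⟨W^k,x⟩, k̃ any label maximizing k ↦ ⟨W^k,x⟩ over k ≠ y, m(y') = ⟨W^{y'},x⟩ − max_{k≠y'}⟨W^k,x⟩, m⋆ = max_k m(k), and a = 1 − max{1[m⋆ > β], m⋆}. Define ℓ(W) = 0 if y⋆ = y and m⋆ > β, and ℓ(W) = max{1 − m(y), 0} otherwise; define g = (e_{k̃} − e_y) ⊗ x if m⋆ ≤ β or y⋆ ≠ y, and g = 0 otherwise. Then (1 − max{a,0})·1[y⋆ ≠ y] + max{a,0}·(K−1)/K − ℓ(W) + (η/2)‖g‖² ≤ 0. -/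
open scoped RealInnerProductSpace BigOperators

/-- Margin `m(W, x, y) = ⟨W^y, x⟩ − max_{k ≠ y} ⟨W^k, x⟩`. -/
noncomputable def margin {K d : ℕ} (W : Fin K → EuclideanSpace ℝ (Fin d))
    (x : EuclideanSpace ℝ (Fin d)) (y : Fin K) : ℝ :=
  ⟪W y, x⟫ - ⨆ k : {k : Fin K // k ≠ y}, ⟪W k.1, x⟫

/-- Per-round surrogate gap bound for the multiclass hinge loss. -/
theorem gaptron_hinge_gap (K d : ℕ) (hK : 2 ≤ K) (hd : 1 ≤ d)
    (X : ℝ) (hX : 0 < X)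
    (β η : ℝ) (hβ : β = 1 / K) (hη : η = (1 - β) / (K * X ^ 2))
    (W : Fin K → EuclideanSpace ℝ (Fin d))
    (x : EuclideanSpace ℝ (Fin d)) (hx : ‖x‖ ≤ X)
    (y ystar ktil : Fin K)
    (hystar : ∀ k, ⟪W k, x⟫ ≤ ⟪W ystar, x⟫)
    (hktil : ktil ≠ y ∧ ∀ k, k ≠ y → ⟪W k, x⟫ ≤ ⟪W ktil, x⟫)
    (mstar : ℝ) (hmstar : mstar = ⨆ k, margin W x k)
    (a : ℝ) (ha : a = 1 - max (if β < mstar then (1 : ℝ) else 0) mstar)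
    (ℓW : ℝ)
    (hℓ : ℓW = if ystar = y ∧ β < mstar then 0 else max (1 - margin W x y) 0)
    (g : Fin K → EuclideanSpace ℝ (Fin d))
    (hg : g = if mstar ≤ β ∨ ystar ≠ y then
        (fun k => ((if k = ktil then (1 : ℝ) else 0) - if k = y then 1 else 0) • x)
      else 0) :
    (1 - max a 0) * (if ystar ≠ y then (1 : ℝ) else 0) + max a 0 * (((K : ℝ) - 1) / K)
      - ℓW + (η / 2) * frob g ^ 2 ≤ 0 := by
  have hKr : (2 : ℝ) ≤ K := by exact_mod_cast hK
  have bdd : ∀ j : Fin K, BddAbove (Set.range fun k : {k : Fin K // k ≠ j} => ⟪W k.1, x⟫) :=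
    fun j => (Set.finite_range _).bddAbove
  have hle : ∀ j k : Fin K, k ≠ j → margin W x j ≤ ⟪W j, x⟫ - ⟪W k, x⟫ := by
    intro j k hkj
    have := le_ciSup (bdd j) ⟨k, hkj⟩
    simp only [margin]
    linarith
  have hge : ∀ (j : Fin K) (c : ℝ), (∀ k, k ≠ j → ⟪W k, x⟫ ≤ c) →
      ⟪W j, x⟫ - c ≤ margin W x j := by
    intro j c hc
    have : Nontrivial (Fin K) := Fin.nontrivial_iff_two_le.mpr hK
    obtain ⟨k0, hk0⟩ := exists_ne j
    have : Nonempty {k : Fin K // k ≠ j} := ⟨⟨k0, hk0⟩⟩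
    have : (⨆ k : {k : Fin K // k ≠ j}, ⟪W k.1, x⟫) ≤ c := ciSup_le fun k => hc k.1 k.2
    simp only [margin]
    linarith
  have hs0 : 0 ≤ margin W x ystar := by
    have := hge ystar _ (fun k _ => hystar k)
    linarith
  have hms : mstar = margin W x ystar := by
    rw [hmstar]
    have : Nonempty (Fin K) := ⟨y⟩
    apply le_antisymm
    · apply ciSup_le
      intro k
      by_cases h : k = ystar
      · rw [h]
      · have h1 := hle k ystar (Ne.symm h)
        have h2 := hystar k
        linarith
    · exact le_ciSup (f := fun k => margin W x k) (Set.finite_range _).bddAbove ystar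
  have hm0 : 0 ≤ mstar := hms ▸ hs0
  have hneg : ystar ≠ y → mstar ≤ - margin W x y := by
    intro h
    have h1 := hle ystar y (Ne.symm h)
    have h2 := hle y ystar h
    linarith
  have hβ0 : 0 < β := by rw [hβ]; positivity
  have hβ1 : β ≤ 1 / 2 := by
    rw [hβ]; exact one_div_le_one_div_of_le (by norm_num) hKr
  have hKβ : ((K : ℝ) - 1) / K = 1 - β := by rw [hβ]; field_simp
  have hη' : η * X ^ 2 = β * (1 - β) := by
    rw [hη, hβ]; field_simp
  have hη0 : 0 ≤ η := by
    rw [hη]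
    apply div_nonneg
    · linarith
    · positivity
  have hxx : ‖x‖ ^ 2 ≤ X ^ 2 := by gcongr
  have hgn : (mstar ≤ β ∨ ystar ≠ y) → (η / 2) * frob g ^ 2 ≤ β * (1 - β) := by
    intro h
    have : frob g ^ 2 = 2 * ‖x‖ ^ 2 := by
      rw [hg, if_pos h, frob, Real.sq_sqrt (Finset.sum_nonneg fun _ _ => sq_nonneg _)]
      have : ∀ k : Fin K,
          ‖((if k = ktil then (1 : ℝ) else 0) - if k = y then 1 else 0) • x‖ ^ 2
          = (if k = ktil then ‖x‖ ^ 2 else 0) + if k = y then ‖x‖ ^ 2 else 0 := by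
        intro k
        by_cases h1 : k = ktil
        · have h2 : k ≠ y := h1 ▸ hktil.1
          simp [h1, hktil.1]
        · by_cases h2 : k = y
          · simp [h2, Ne.symm hktil.1]
          · simp [h1, h2]
      rw [Finset.sum_congr rfl fun k _ => this k, Finset.sum_add_distrib]
      simp
      ring
    rw [this]
    nlinarith [mul_le_mul_of_nonneg_left hxx hη0]
  rw [hKβ]
  by_cases hb : β < mstar
  · have hmax : max a 0 = 0 := by
      apply max_eq_right
      rw [ha, if_pos hb]
      have := le_max_left (1 : ℝ) mstar
      linarith
    rw [hmax]
    by_cases hy : ystar = y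
    · have hg0 : g = 0 := by
        rw [hg, if_neg]
        push Not
        exact ⟨hb, hy⟩
      rw [if_pos ⟨hy, hb⟩] at hℓ
      rw [hℓ, hg0]
      simp [hy, frob]
    · have h1 := hgn (Or.inr hy)
      have h2 := hneg hy
      rw [if_neg (fun h => hy h.1)] at hℓ
      rw [hℓ, if_pos hy]
      have h3 := le_max_left (1 - margin W x y) 0
      nlinarith
  · have hb' := not_lt.mp hb
    have hmax : max a 0 = 1 - mstar := by
      rw [ha, if_neg hb, max_eq_right hm0]
      apply max_eq_left
      linarith
    have h1 := hgn (Or.inl hb')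
    have h3 := le_max_left (1 - margin W x y) 0
    rw [if_neg (fun h => hb h.2)] at hℓ
    rw [hmax, hℓ]
    by_cases hy : ystar = y
    · rw [if_neg (not_not.mpr hy)]
      rw [hy] at hms
      nlinarith
    · rw [if_pos hy]
      have h2 := hneg hy
      nlinarith
end

section
/- Per-round surrogate gap bound for the smooth multiclass hinge loss: Let K ≥ 2, d ≥ 1, X > 0 and η = 1/(4KX²). Let W ∈ ℝ^{K×d}, x ∈ ℝ^d with ‖x‖ ≤ X, and y ∈ {1,…,K}. Let y⋆ be any label maximizing k ↦ ⟨W^k,x⟩, k̃ any label maximizing k ↦ ⟨W^k,x⟩ over k ≠ y, m(y') = ⟨W^{y'},x⟩ − max_{k≠y'}⟨W^k,x⟩, m⋆ = max_k m(k), and a = (1 − min{1, m⋆})². Define ℓ(W) = max{1 − 2m(y), 0} if m(y) ≤ 0 and ℓ(W) = (1 − m(y))² if m(y) > 0; define g = 2(e_{k̃} − e_y) ⊗ x if y⋆ ≠ y, g = 2(1 − m⋆)(e_{k̃} − e_y) ⊗ x if y⋆ = y and m⋆ < 1, and g = 0 if y⋆ = y and m⋆ ≥ 1. Then (1 − a)·1[y⋆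 ≠ y] + a·(K−1)/K − ℓ(W) + (η/2)‖g‖² ≤ 0. -/
open scoped RealInnerProductSpace BigOperators

theorem margin_le_aux {K d : ℕ} (W : Fin K → EuclideanSpace ℝ (Fin d))
    (x : EuclideanSpace ℝ (Fin d)) (y k : Fin K) (h : k ≠ y) :
    margin W x y ≤ ⟪W y, x⟫ - ⟪W k, x⟫ := by
  unfold margin
  have := le_ciSup (f := fun k : {k : Fin K // k ≠ y} => ⟪W k.1, x⟫)
    (Set.finite_range _).bddAbove ⟨k, h⟩
  simp only at this
  linarith

theorem le_margin_aux {K d : ℕ} (W : Fin K → EuclideanSpace ℝ (Fin d))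
    (x : EuclideanSpace ℝ (Fin d)) (y j : Fin K) (hj : j ≠ y) (c : ℝ)
    (h : ∀ k, k ≠ y → ⟪W k, x⟫ ≤ c) :
    ⟪W y, x⟫ - c ≤ margin W x y := by
  unfold margin
  haveI : Nonempty {k : Fin K // k ≠ y} := ⟨⟨j, hj⟩⟩
  have := ciSup_le (f := fun k : {k : Fin K // k ≠ y} => ⟪W k.1, x⟫) (c := c)
    (fun k => h k.1 k.2)
  linarith

theorem frob_aux {K d : ℕ} (x : EuclideanSpace ℝ (Fin d)) (y j : Fin K) (hj : j ≠ y) (c : ℝ) :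
    frob (fun k => (c * ((if k = j then (1 : ℝ) else 0) - if k = y then 1 else 0)) • x) ^ 2
      = 2 * c ^ 2 * ‖x‖ ^ 2 := by
  unfold frob
  rw [Real.sq_sqrt (Finset.sum_nonneg fun _ _ => sq_nonneg _)]
  have : ∀ k : Fin K,
      ‖(c * ((if k = j then (1 : ℝ) else 0) - if k = y then 1 else 0)) • x‖ ^ 2
      = (if k = j then c ^ 2 * ‖x‖ ^ 2 else 0) + (if k = y then c ^ 2 * ‖x‖ ^ 2 else 0) := by
    intro k
    rw [norm_smul, mul_pow, Real.norm_eq_abs, sq_abs]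
    by_cases h1 : k = j
    · have h2 : k ≠ y := h1 ▸ hj
      simp [h1, hj]
    · by_cases h2 : k = y <;> simp [h1, h2, Ne.symm hj]
  simp only [this, Finset.sum_add_distrib, Finset.sum_ite_eq', Finset.mem_univ, if_true]
  ring

/-- Per-round surrogate gap bound for the smooth multiclass hinge loss. -/
theorem gaptron_smooth_hinge_gap (K d : ℕ) (hK : 2 ≤ K) (hd : 1 ≤ d)
    (X : ℝ) (hX : 0 < X)
    (η : ℝ) (hη : η = 1 / (4 * K * X ^ 2))
    (W : Fin K → EuclideanSpace ℝ (Fin d))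
    (x : EuclideanSpace ℝ (Fin d)) (hx : ‖x‖ ≤ X)
    (y ystar ktil : Fin K)
    (hystar : ∀ k, ⟪W k, x⟫ ≤ ⟪W ystar, x⟫)
    (hktil : ktil ≠ y ∧ ∀ k, k ≠ y → ⟪W k, x⟫ ≤ ⟪W ktil, x⟫)
    (mstar : ℝ) (hmstar : mstar = ⨆ k, margin W x k)
    (a : ℝ) (ha : a = (1 - min 1 mstar) ^ 2)
    (ℓW : ℝ)
    (hℓ : ℓW = if margin W x y ≤ 0 then max (1 - 2 * margin W x y) 0
      else (1 - margin W x y) ^ 2)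
    (g : Fin K → EuclideanSpace ℝ (Fin d))
    (hg : g =
      if ystar ≠ y then
        (fun k => (2 * ((if k = ktil then (1 : ℝ) else 0) - if k = y then 1 else 0)) • x)
      else if mstar < 1 then
        (fun k => (2 * (1 - mstar) *
          ((if k = ktil then (1 : ℝ) else 0) - if k = y then 1 else 0)) • x)
      else 0) :
    (1 - a) * (if ystar ≠ y then (1 : ℝ) else 0) + a * (((K : ℝ) - 1) / K)
      - ℓW + (η / 2) * frob g ^ 2 ≤ 0 := by
  have hKpos : (0 : ℝ) < K := by exact_mod_cast (by omega : 0 < K)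
  have hK1 : (1 : ℝ) ≤ K := by exact_mod_cast (by omega : 1 ≤ K)
  haveI : Nonempty (Fin K) := ⟨y⟩
  obtain ⟨hky, hkmax⟩ := hktil
  have hex : ∃ j : Fin K, j ≠ ystar := by
    by_cases h : y = ystar
    · exact ⟨ktil, h ▸ hky⟩
    · exact ⟨y, h⟩
  obtain ⟨j, hj⟩ := hex
  have hm0 : 0 ≤ margin W x ystar := by
    have := le_margin_aux W x ystar j hj _ (fun k _ => hystar k)
    linarith
  have hms : mstar = margin W x ystar := by
    rw [hmstar]
    apply le_antisymm
    · apply ciSup_le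
      intro k
      by_cases h : k = ystar
      · rw [h]
      · have h1 := margin_le_aux W x k ystar (Ne.symm h)
        have h2 := hystar k
        linarith
    · exact le_ciSup (Set.finite_range _).bddAbove ystar
  rw [← hms] at hm0
  have hE : η / 2 * (8 * ‖x‖ ^ 2) ≤ 1 / K := by
    have h1 : ‖x‖ ^ 2 ≤ X ^ 2 := pow_le_pow_left₀ (norm_nonneg _) hx 2
    rw [hη]
    have h2 : 1 / (4 * (K : ℝ) * X ^ 2) / 2 * (8 * ‖x‖ ^ 2) = (1 / K) * (‖x‖ ^ 2 / X ^ 2) := by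
      field_simp
      norm_num
    rw [h2]
    have h3 : ‖x‖ ^ 2 / X ^ 2 ≤ 1 := (div_le_one (by positivity)).2 h1
    have h4 : (0 : ℝ) ≤ 1 / K := by positivity
    nlinarith
  have hKK : ((K : ℝ) - 1) / K = 1 - 1 / K := by field_simp
  have hu0 : (0 : ℝ) ≤ 1 / K := by positivity
  have hu1 : (1 : ℝ) / K ≤ 1 := (div_le_one hKpos).2 hK1
  rw [hKK]
  generalize (1 : ℝ) / K = u at *
  by_cases hy : ystar = y
  · subst hy
    rw [← hms] at hℓ
    simp only [ne_eq, not_true_eq_false, if_false] at hg ⊢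
    by_cases h1 : mstar < 1
    · rw [if_pos h1] at hg
      rw [hg, frob_aux x ystar ktil hky]
      rw [min_eq_right h1.le] at ha
      have hl : ℓW = a := by
        rw [hℓ, ha]
        split_ifs with h
        · have : mstar = 0 := le_antisymm h hm0
          rw [this]; norm_num
        · rfl
      have h5 : η / 2 * (2 * (2 * (1 - mstar)) ^ 2 * ‖x‖ ^ 2)
          = a * (η / 2 * (8 * ‖x‖ ^ 2)) := by rw [ha]; ring
      rw [h5, hl]
      have ha0 : 0 ≤ a := by rw [ha]; positivity
      nlinarith
    · rw [if_neg h1] at hg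
      have hf : frob g = 0 := by rw [hg]; simp [frob]
      rw [min_eq_left (not_lt.1 h1)] at ha
      rw [if_neg (by linarith)] at hℓ
      rw [hf, ha, hℓ]
      nlinarith [sq_nonneg (1 - mstar)]
  · simp only [ne_eq, hy, not_false_eq_true, if_true] at hg ⊢
    rw [hg, frob_aux x y ktil hky]
    have h1 := margin_le_aux W x y ystar hy
    have h2 := margin_le_aux W x ystar y (Ne.symm hy)
    rw [← hms] at h2
    rw [if_pos (by linarith)] at hℓ
    have h3 : 1 + 2 * mstar ≤ ℓW := by
      rw [hℓ]; exact le_trans (by linarith) (le_max_left _ _)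
    have h4 : η / 2 * (2 * 2 ^ 2 * ‖x‖ ^ 2) = η / 2 * (8 * ‖x‖ ^ 2) := by ring
    rw [h4]
    have h5 : 1 - a ≤ 2 * mstar := by
      rw [ha]
      have := min_le_right 1 mstar
      nlinarith [sq_nonneg (min 1 mstar)]
    nlinarith
end

section
/- Per-round surrogate gap bound for the bandit logistic loss: Let K ≥ 2, d ≥ 1, X > 0, δ ∈ (0,1] and η = ln(2)·δ/(2KX²). Let W ∈ ℝ^{K×d}, x ∈ ℝ^d with ‖x‖ ≤ X, y ∈ {1,…,K}, and p ∈ [δ,1] (the probability with which the algorithm plays label y). Set p̃(k) = σ(W,x,k), p⋆ = max_k p̃(k), let y⋆ be any label maximizing p̃, let a = 1 − p⋆ if p⋆ ≥ 1/2 and a = 1 otherwise, and let g = (1/ln 2)(p̃ − e_y) ⊗ x. Then (1 − a)·1[y⋆ ≠ y] + a·(K−1)/K + log₂ p̃(y) + (η/(2p))‖g‖² ≤ 0. -/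
open scoped RealInnerProductSpace BigOperators

theorem softmax_aux {K : ℕ} (P : Fin K → ℝ) (hpos : ∀ k, 0 < P k) (hsum : ∑ k, P k = 1) (y : Fin K) :
    (∀ k, k ≠ y → P k ≤ 1 - P y) ∧ P y ≤ 1 ∧
    ∑ k, (P k - if k = y then 1 else 0) ^ 2 ≤ 2 * (1 - P y) ^ 2 := by
  have h1 : P y + ∑ k ∈ Finset.univ.erase y, P k = 1 := by
    rw [Finset.add_sum_erase _ _ (Finset.mem_univ y), hsum]
  have hle : ∀ k, k ≠ y → P k ≤ 1 - P y := by
    intro k hk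
    have := Finset.single_le_sum (f := P) (fun i _ => (hpos i).le)
      (Finset.mem_erase.2 ⟨hk, Finset.mem_univ k⟩)
    linarith
  have h0 : 0 ≤ ∑ k ∈ Finset.univ.erase y, P k := Finset.sum_nonneg fun i _ => (hpos i).le
  refine ⟨hle, by linarith, ?_⟩
  rw [← Finset.add_sum_erase _ _ (Finset.mem_univ y)]
  have h2 : ∑ k ∈ Finset.univ.erase y, (P k - if k = y then 1 else 0) ^ 2
      ≤ ∑ k ∈ Finset.univ.erase y, (1 - P y) * P k := by
    apply Finset.sum_le_sum
    intro k hk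
    have hk' := Finset.ne_of_mem_erase hk
    rw [if_neg hk']
    nlinarith [hle k hk', hpos k]
  rw [← Finset.mul_sum] at h2
  have h3 : ∑ k ∈ Finset.univ.erase y, P k = 1 - P y := by linarith
  rw [h3] at h2
  simp only [if_true]
  nlinarith

set_option maxHeartbeats 1000000 in
/-- Per-round surrogate gap bound for the bandit logistic loss. -/
theorem gaptron_bandit_logistic_gap (K d : ℕ) (hK : 2 ≤ K) (hd : 1 ≤ d)
    (X : ℝ) (hX : 0 < X)
    (δ : ℝ) (hδ : 0 < δ ∧ δ ≤ 1)
    (η : ℝ) (hη : η = Real.log 2 * δ / (2 * K * X ^ 2))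
    (W : Fin K → EuclideanSpace ℝ (Fin d))
    (x : EuclideanSpace ℝ (Fin d)) (hx : ‖x‖ ≤ X)
    (y ystar : Fin K)
    (p : ℝ) (hp : p ∈ Set.Icc δ 1)
    (hystar : ∀ k, softmax W x k ≤ softmax W x ystar)
    (pstar : ℝ) (hpstar : pstar = ⨆ k, softmax W x k)
    (a : ℝ) (ha : a = if (1 : ℝ) / 2 ≤ pstar then 1 - pstar else 1)
    (g : Fin K → EuclideanSpace ℝ (Fin d))
    (hg : g = fun k => ((1 / Real.log 2) * (softmax W x k - if k = y then 1 else 0)) • x) :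
    (1 - a) * (if ystar ≠ y then (1 : ℝ) else 0) + a * (((K : ℝ) - 1) / K)
      + Real.logb 2 (softmax W x y) + (η / (2 * p)) * frob g ^ 2 ≤ 0 := by
  have hKpos : (0 : ℝ) < K := by positivity
  have hK2 : (2 : ℝ) ≤ K := by exact_mod_cast hK
  have hne : Nonempty (Fin K) := ⟨y⟩
  have hZ : 0 < ∑ j, Real.exp ⟪W j, x⟫ :=
    Finset.sum_pos (fun _ _ => Real.exp_pos _) Finset.univ_nonempty
  have hpos : ∀ k, 0 < softmax W x k := fun k => div_pos (Real.exp_pos _) hZ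
  have hsum : ∑ k, softmax W x k = 1 := by
    unfold softmax
    rw [← Finset.sum_div, div_self hZ.ne']
  have hps : pstar = softmax W x ystar := by
    rw [hpstar]
    exact le_antisymm (ciSup_le hystar) (le_ciSup (Set.finite_range _).bddAbove ystar)
  obtain ⟨hle, hq1, hS⟩ := softmax_aux (softmax W x) hpos hsum y
  have hfrob : frob g ^ 2 = ‖x‖ ^ 2 / Real.log 2 ^ 2 *
      ∑ k, (softmax W x k - if k = y then 1 else 0) ^ 2 := by
    unfold frob
    rw [Real.sq_sqrt (Finset.sum_nonneg fun _ _ => sq_nonneg _), Finset.mul_sum, hg]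
    refine Finset.sum_congr rfl fun k _ => ?_
    simp only [norm_smul, mul_pow, Real.norm_eq_abs, sq_abs, div_pow, one_pow]
    ring
  have hS0 : 0 ≤ ∑ k, (softmax W x k - if k = y then (1 : ℝ) else 0) ^ 2 :=
    Finset.sum_nonneg fun _ _ => sq_nonneg _
  have hqs := hystar y
  have hq0 := hpos y
  rw [hfrob]
  generalize (∑ k, (softmax W x k - if k = y then (1 : ℝ) else 0) ^ 2) = S at *
  have hL1 := Real.log_two_gt_d9
  have hL2 := Real.log_two_lt_d9
  have hlog : ∀ c : ℝ, 0 < c → Real.log c ≤ c - 1 := fun c hc => Real.log_le_sub_one_of_pos hc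
  have hsame : ystar = y → softmax W x ystar = softmax W x y := fun h => by rw [h]
  have hdiff : ystar ≠ y → softmax W x ystar ≤ 1 - softmax W x y := hle ystar
  have hl1 := hlog _ hq0
  have hl2 := hlog _ (mul_pos two_pos hq0)
  rw [Real.log_mul two_ne_zero hq0.ne'] at hl2
  have hl3 := Real.log_le_log_iff (x := softmax W x y) (y := 1 / 2) hq0 (by norm_num)
  rw [one_div, Real.log_inv] at hl3
  have hpp : 0 < p := lt_of_lt_of_le hδ.1 hp.1
  have hterm : η / (2 * p) * (‖x‖ ^ 2 / Real.log 2 ^ 2 * S) ≤ S / (4 * K * Real.log 2) := by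
    have hx2 : ‖x‖ ^ 2 ≤ X ^ 2 := pow_le_pow_left₀ (norm_nonneg _) hx 2
    have e : η / (2 * p) * (‖x‖ ^ 2 / Real.log 2 ^ 2 * S)
        = (δ / p) * (‖x‖ ^ 2 / X ^ 2) * (S / (4 * K * Real.log 2)) := by
      rw [hη]
      have : Real.log 2 ≠ 0 := by linarith
      field_simp
      ring
    rw [e]
    have a1 : δ / p ≤ 1 := (div_le_one hpp).2 hp.1
    have a2 : ‖x‖ ^ 2 / X ^ 2 ≤ 1 := (div_le_one (by positivity)).2 hx2
    have a3 : 0 ≤ S / (4 * K * Real.log 2) := by positivity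
    have a4 : δ / p * (‖x‖ ^ 2 / X ^ 2) ≤ 1 :=
      mul_le_one₀ a1 (by positivity) a2
    nlinarith
  refine le_trans (add_le_add_right hterm _) ?_
  rw [Real.logb]
  rw [hps] at ha
  generalize softmax W x ystar = m at *
  generalize hqd : softmax W x y = q at *
  generalize Real.log q = l at *
  generalize Real.log 2 = L at *
  have hLpos : 0 < L := by linarith
  have key : ∀ u : ℝ, K * L * u + (a * (K - 1) * L + K * l + S / 4) ≤ 0 →
      u + a * (((K : ℝ) - 1) / K) + l / L + S / (4 * K * L) ≤ 0 := by
    intro u hu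
    have e : u + a * (((K : ℝ) - 1) / K) + l / L + S / (4 * K * L)
      = (K * L * u + (a * (K - 1) * L + K * l + S / 4)) / (K * L) := by
      field_simp
      ring
    rw [e]
    exact div_nonpos_of_nonpos_of_nonneg hu (by positivity)
  apply key
  by_cases hm : (1 : ℝ) / 2 ≤ m
  · rw [if_pos hm] at ha
    by_cases hy : ystar = y
    · have hmq : m = q := hsame hy
      subst hmq
      simp only [hy, ne_eq, not_true_eq_false, if_false, ha]
      have h1 : K * l ≤ K * (m - 1) := by gcongr
      have h2 : S / 4 ≤ (1 - m) * L := by nlinarith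
      have h3 : 0 ≤ K * (1 - m) * (1 - L) := by
        apply mul_nonneg (mul_nonneg _ _) <;> linarith
      linarith
    · have hd' := hdiff hy
      simp only [hy, ne_eq, not_false_eq_true, if_true, ha]
      have hq2 : q ≤ 1 / 2 := by linarith
      have h1 : K * (l + L) ≤ K * (2 * q - 1) := by gcongr; linarith
      have h2 : (K : ℝ) * (2 * q - 1) ≤ 2 * (2 * q - 1) := by nlinarith
      have h3 : q * L ≤ (1 - m) * L := by gcongr; linarith
      have h4 : S / 4 ≤ q * L + 2 * (1 - 2 * q) := by nlinarith
      linarith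
  · rw [if_neg hm] at ha
    subst ha
    push Not at hm
    have h1 : l ≤ -L := hl3.2 (by linarith)
    have h2 : K * l ≤ K * (-L) := by gcongr
    have h3 : S / 4 ≤ L := by nlinarith
    simp only [sub_self, zero_mul, mul_zero]
    linarith
end

section
/- Per-round surrogate gap bound for the bandit multiclass hinge loss: Let K ≥ 2, d ≥ 1, X > 0, γ ∈ (0,1], β = 1/K and η = γ(1−β)/(K²X²). Let W ∈ ℝ^{K×d}, x ∈ ℝ^d with ‖x‖ ≤ X, y ∈ {1,…,K}, and p ∈ [γ/K, 1] (the probability with which the algorithm plays label y). Let y⋆ be any label maximizing k ↦ ⟨W^k,x⟩, k̃ any label maximizing k ↦ ⟨W^k,x⟩ over k ≠ y, m(y') = ⟨W^{y'},x⟩ − max_{k≠y'}⟨W^k,x⟩, m⋆ = max_k m(k), and a = 1 − max{1[m⋆ > β], m⋆}. Define ℓ(W) = 0 if y⋆ = y and m⋆ > β, and ℓ(W) = max{1 − m(y), 0} otherwise; define g = (e_{k̃} − e_y) ⊗ x if m⋆ ≤ β or y⋆ ≠ y, and g = 0 otherwise. Then (1 − max{a,0})·1[y⋆ ≠ y] +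 max{a,0}·(K−1)/K − ℓ(W) + (η/(2p))‖g‖² ≤ 0. -/
open scoped RealInnerProductSpace BigOperators

/-- Per-round surrogate gap bound for the bandit multiclass hinge loss. -/
theorem gaptron_bandit_hinge_gap (K d : ℕ) (hK : 2 ≤ K) (hd : 1 ≤ d)
    (X : ℝ) (hX : 0 < X)
    (γ : ℝ) (hγ : 0 < γ ∧ γ ≤ 1)
    (β η : ℝ) (hβ : β = 1 / K) (hη : η = γ * (1 - β) / (K ^ 2 * X ^ 2))
    (W : Fin K → EuclideanSpace ℝ (Fin d))
    (x : EuclideanSpace ℝ (Fin d)) (hx : ‖x‖ ≤ X)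
    (y ystar ktil : Fin K)
    (p : ℝ) (hp : p ∈ Set.Icc (γ / K) 1)
    (hystar : ∀ k, ⟪W k, x⟫ ≤ ⟪W ystar, x⟫)
    (hktil : ktil ≠ y ∧ ∀ k, k ≠ y → ⟪W k, x⟫ ≤ ⟪W ktil, x⟫)
    (mstar : ℝ) (hmstar : mstar = ⨆ k, margin W x k)
    (a : ℝ) (ha : a = 1 - max (if β < mstar then (1 : ℝ) else 0) mstar)
    (ℓW : ℝ)
    (hℓ : ℓW = if ystar = y ∧ β < mstar then 0 else max (1 - margin W x y) 0)
    (g : Fin K → EuclideanSpace ℝ (Fin d))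
    (hg : g = if mstar ≤ β ∨ ystar ≠ y then
        (fun k => ((if k = ktil then (1 : ℝ) else 0) - if k = y then 1 else 0) • x)
      else 0) :
    (1 - max a 0) * (if ystar ≠ y then (1 : ℝ) else 0) + max a 0 * (((K : ℝ) - 1) / K)
      - ℓW + (η / (2 * p)) * frob g ^ 2 ≤ 0 := by
  obtain ⟨hk1, hk2⟩ := hktil
  obtain ⟨hγ0, hγ1⟩ := hγ
  have hKR : (2 : ℝ) ≤ K := by exact_mod_cast hK
  have hK0 : (0 : ℝ) < K := by linarith
  -- margin facts
  have hup : ∀ k j : Fin K, j ≠ k → margin W x k ≤ ⟪W k, x⟫ - ⟪W j, x⟫ := by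
    intro k j hj
    unfold margin
    have := le_ciSup (f := fun i : {i : Fin K // i ≠ k} => ⟪W i.1, x⟫)
      (Set.finite_range _).bddAbove ⟨j, hj⟩
    simp only at this
    linarith
  have hne : ∀ k : Fin K, ∃ j : Fin K, j ≠ k := by
    intro k
    by_cases h : k = y
    · exact ⟨ktil, h ▸ hk1⟩
    · exact ⟨y, fun h' => h h'.symm⟩
  have hs0 : 0 ≤ margin W x ystar := by
    obtain ⟨j, hj⟩ := hne ystar
    haveI : Nonempty {k : Fin K // k ≠ ystar} := ⟨⟨j, hj⟩⟩
    unfold margin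
    have := ciSup_le (f := fun i : {i : Fin K // i ≠ ystar} => ⟪W i.1, x⟫)
      (fun i => hystar i.1)
    linarith
  have hle : ∀ k, margin W x k ≤ mstar := by
    intro k
    rw [hmstar]
    exact le_ciSup (f := fun k => margin W x k) (Set.finite_range _).bddAbove k
  have hms : mstar ≤ margin W x ystar := by
    rw [hmstar]
    haveI : Nonempty (Fin K) := ⟨y⟩
    refine ciSup_le fun k => ?_
    by_cases h : k = ystar
    · rw [h]
    · have := hup k ystar (fun h' => h h'.symm)
      have := hystar k
      linarith
  have hm0 : 0 ≤ mstar := hs0.trans (hle _)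
  have hmy : ystar ≠ y → margin W x y ≤ -mstar := by
    intro h
    have h1 := hup y ystar h
    have h2 := hup ystar y h.symm
    linarith
  have hmyl := hle y
  -- gradient term
  have hβ0 : 0 < β := by rw [hβ]; positivity
  have hβ1 : β ≤ 1 / 2 := by
    rw [hβ]; exact one_div_le_one_div_of_le (by norm_num) hKR
  have hKβ : ((K : ℝ) - 1) / K = 1 - β := by rw [hβ]; field_simp
  have hp0 : 0 < p := lt_of_lt_of_le (by positivity) hp.1
  have hG : ∀ f : Fin K → EuclideanSpace ℝ (Fin d),
      f = (fun k => ((if k = ktil then (1 : ℝ) else 0) - if k = y then 1 else 0) • x) →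
      (η / (2 * p)) * frob f ^ 2 ≤ β * (1 - β) := by
    intro f hf
    have h1 : frob f ^ 2 = 2 * ‖x‖ ^ 2 := by
      unfold frob
      rw [Real.sq_sqrt (Finset.sum_nonneg fun _ _ => by positivity)]
      have : ∀ k, ‖f k‖ ^ 2 = (if k = ktil then ‖x‖ ^ 2 else 0) + (if k = y then ‖x‖ ^ 2 else 0) := by
        intro k
        rw [hf]
        by_cases h1 : k = ktil
        · have : k ≠ y := h1 ▸ hk1
          simp [h1, hk1]
        · by_cases h2 : k = y
          · simp [h2, hk1.symm]
          · simp [h1, h2]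
      simp only [this, Finset.sum_add_distrib, Finset.sum_ite_eq', Finset.mem_univ, if_true]
      ring
    have hx2 : ‖x‖ ^ 2 ≤ X ^ 2 := by gcongr
    have hpK : γ ≤ p * K := by
      have := hp.1
      rwa [div_le_iff₀ hK0] at this
    have hη0 : 0 ≤ η := by
      rw [hη]
      have : 0 ≤ 1 - β := by linarith
      positivity
    have e : η * X ^ 2 = γ * (1 - β) * β ^ 2 := by
      rw [hη, hβ]; field_simp
    have hpβ : γ * β ≤ p := by
      rw [hβ, mul_one_div]; exact hp.1
    rw [h1]
    have : η / (2 * p) * (2 * ‖x‖ ^ 2) = η * ‖x‖ ^ 2 / p := by field_simp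
    rw [this, div_le_iff₀ hp0]
    calc η * ‖x‖ ^ 2 ≤ η * X ^ 2 := by gcongr
      _ = (β * (1 - β)) * (γ * β) := by rw [e]; ring
      _ ≤ (β * (1 - β)) * p := by
        apply mul_le_mul_of_nonneg_left hpβ
        exact mul_nonneg hβ0.le (by linarith)
  rw [hKβ]
  by_cases hb : β < mstar
  · have ha0 : max a 0 = 0 := by
      rw [ha, if_pos hb]
      apply max_eq_right
      have := le_max_left (1 : ℝ) mstar
      linarith
    rw [ha0]
    by_cases hy : ystar = y
    · rw [if_neg (by simp [not_le.mpr hb, hy])] at hg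
      rw [if_pos ⟨hy, hb⟩] at hℓ
      simp [hℓ, hg, hy, frob]
    · rw [if_pos (Or.inr hy)] at hg
      rw [if_neg (by simp [hy])] at hℓ
      have h1 := hG g hg
      have h2 := le_max_left (1 - margin W x y) 0
      have h3 := hmy hy
      rw [if_pos hy]
      nlinarith
  · have hb' := not_lt.mp hb
    have ha0 : max a 0 = 1 - mstar := by
      rw [ha, if_neg hb, max_eq_right hm0]
      apply max_eq_left
      linarith
    rw [ha0]
    rw [if_pos (Or.inl hb')] at hg
    rw [if_neg (by simp [hb])] at hℓ
    have h1 := hG g hg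
    have h2 := le_max_left (1 - margin W x y) 0
    by_cases hy : ystar = y
    · rw [if_neg (by simp [hy])]
      nlinarith
    · have h3 := hmy hy
      rw [if_pos hy]
      nlinarith
end

section
/- Theorem D.2 (constant regret for online classification with abstention): Under the online classification with abstention setup, assume T ≥ 1, c_t < 1/2 for all t, and the AdaHedge guarantee: for every expert i, Σ_{t=1}^T (ℓ_t(ŷ_t) − ℓ_t(y_t^i)) ≤ 2√(ln(d) Σ_{t=1}^T v_t) + (4/3)ln(d) + 2. Then for every expert i: Σ_{t=1}^T ((1 − b_t)ℓ_t(y_t⋆) + b_t c_t) ≤ Σ_{t=1}^T ℓ_t(y_t^i) + min{ ln(d)/(1 − 2·max_{t≤T} c_t), 2√(ln(d) Σ_{t=1}^T v_t) } + (4/3)ln(d) + 2. -/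
open scoped BigOperators

/-- Theorem D.2 (constant regret for online classification with abstention). The loss of a
prediction `z ∈ [−1,1]` against the true label `y ∈ {−1,1}` is `(1 − y·z)/2`. -/
theorem adahedge_abstention_constant_regret (d T : ℕ) (hd : 2 ≤ d) (hT : 1 ≤ T)
    (yE : Fin T → Fin d → ℝ) (hyE : ∀ t i, yE t i ∈ Set.Icc (-1 : ℝ) 1)
    (phat : Fin T → Fin d → ℝ)
    (hphat0 : ∀ t i, 0 ≤ phat t i) (hphat1 : ∀ t, ∑ i, phat t i = 1)
    (yhat : Fin T → ℝ) (hyhat : ∀ t, yhat t = ∑ i, phat t i * yE t i)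
    (ystar : Fin T → ℝ)
    (hystar : ∀ t, (ystar t = 1 ∨ ystar t = -1) ∧ ystar t * yhat t = |yhat t|)
    (b : Fin T → ℝ) (hb : ∀ t, b t = 1 - |yhat t|)
    (y : Fin T → ℝ) (hy : ∀ t, y t = 1 ∨ y t = -1)
    (c : Fin T → ℝ) (hc : ∀ t, c t ∈ Set.Icc (0 : ℝ) 1)
    (hchalf : ∀ t, c t < 1 / 2)
    (v : Fin T → ℝ)
    (hv : ∀ t, v t = ∑ i, phat t i *
      ((1 - y t * yhat t) / 2 - (1 - y t * yE t i) / 2) ^ 2)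
    (hAH : ∀ i : Fin d, ∑ t, ((1 - y t * yhat t) / 2 - (1 - y t * yE t i) / 2)
      ≤ 2 * Real.sqrt (Real.log d * ∑ t, v t) + 4 / 3 * Real.log d + 2)
    (i : Fin d) :
    ∑ t, ((1 - b t) * ((1 - y t * ystar t) / 2) + b t * c t)
      ≤ ∑ t, ((1 - y t * yE t i) / 2)
        + min (Real.log d / (1 - 2 * ⨆ t, c t))
            (2 * Real.sqrt (Real.log d * ∑ t, v t))
        + 4 / 3 * Real.log d + 2 := by
  have : Nonempty (Fin T) := ⟨⟨0, hT⟩⟩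
  set η : ℝ := 1 - 2 * ⨆ t, c t with hη
  have hcle : ∀ t, c t ≤ ⨆ t, c t := fun t => le_ciSup (Set.finite_range c).bddAbove t
  have hηpos : 0 < η := by
    obtain ⟨t0, ht0⟩ := exists_eq_ciSup_of_finite (f := c)
    have := hchalf t0
    rw [hη, ← ht0]
    linarith
  have hL : 0 ≤ Real.log d := Real.log_natCast_nonneg d
  have hv0 : ∀ t, 0 ≤ v t := fun t => by
    rw [hv t]
    exact Finset.sum_nonneg fun j _ => mul_nonneg (hphat0 t j) (sq_nonneg _)
  have hysq : ∀ t, y t ^ 2 = 1 := fun t => by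
    rcases hy t with h | h <;> rw [h] <;> norm_num
  have hvle : ∀ t, v t ≤ (1 - yhat t ^ 2) / 4 := fun t => by
    have h1 : v t ≤ ∑ j, (phat t j * (1 / 4) + yhat t ^ 2 / 4 * phat t j
        - yhat t / 2 * (phat t j * yE t j)) := by
      rw [hv t]
      apply Finset.sum_le_sum
      intro j _
      have hE : yE t j ^ 2 ≤ 1 := by
        have := hyE t j
        nlinarith [this.1, this.2]
      have e : ((1 - y t * yhat t) / 2 - (1 - y t * yE t j) / 2) ^ 2
          = (yhat t - yE t j) ^ 2 / 4 := by
        linear_combination ((yhat t - yE t j) ^ 2 / 4) * hysq t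
      rw [e]
      nlinarith [mul_le_mul_of_nonneg_left hE (hphat0 t j)]
    rw [Finset.sum_sub_distrib, Finset.sum_add_distrib, ← Finset.sum_mul, ← Finset.mul_sum,
      ← Finset.mul_sum, hphat1 t, ← hyhat t] at h1
    linarith
  have habs : ∀ t, |yhat t| ≤ 1 := fun t => by
    rw [← sq_le_one_iff_abs_le_one]
    linarith [hv0 t, hvle t]
  have hround : ∀ t, (1 - b t) * ((1 - y t * ystar t) / 2) + b t * c t
      ≤ (1 - y t * yhat t) / 2 - η * v t := fun t => by
    have hs : |yhat t| * ystar t = yhat t := by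
      rw [← (hystar t).2]
      rcases (hystar t).1 with h | h <;> rw [h] <;> ring
    have h2 : v t ≤ (1 - |yhat t|) / 2 := by
      have := hvle t
      rw [← sq_abs] at this
      nlinarith [habs t, sq_nonneg (1 - |yhat t|)]
    have h3 : η ≤ 1 - 2 * c t := by linarith [hcle t]
    have h4 : η * v t ≤ (1 - 2 * c t) * ((1 - |yhat t|) / 2) :=
      mul_le_mul h3 h2 (hv0 t) (by linarith)
    rw [hb t]
    have e : (1 - (1 - |yhat t|)) * ((1 - y t * ystar t) / 2) + (1 - |yhat t|) * c t
        = (1 - y t * yhat t) / 2 - (1 - 2 * c t) * ((1 - |yhat t|) / 2) := by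
      linear_combination (-y t / 2) * hs
    linarith
  have hsum := Finset.sum_le_sum fun t (_ : t ∈ Finset.univ) => hround t
  rw [Finset.sum_sub_distrib, ← Finset.mul_sum] at hsum
  have hA := hAH i
  rw [Finset.sum_sub_distrib] at hA
  have hV : 0 ≤ ∑ t, v t := Finset.sum_nonneg fun t _ => hv0 t
  generalize (∑ t, v t) = V at *
  have hm1 : 2 * Real.sqrt (Real.log d * V) - η * V ≤ Real.log d / η := by
    rw [le_div_iff₀ hηpos, Real.sqrt_mul hL V]
    have h1 := Real.sq_sqrt hL
    have h2 := Real.sq_sqrt hV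
    have h3 : η ^ 2 * Real.sqrt V ^ 2 = η ^ 2 * V := by rw [h2]
    have h4 := sq_nonneg (Real.sqrt (Real.log d) - η * Real.sqrt V)
    linarith only [h1, h3, h4]
  have hm2 : 0 ≤ η * V := mul_nonneg hηpos.le hV
  have hm : 2 * Real.sqrt (Real.log d * V) - η * V
      ≤ min (Real.log d / η) (2 * Real.sqrt (Real.log d * V)) := le_min hm1 (by linarith)
  linarith
end

section
/- Per-round abstention gap bound: Let y ∈ {−1,1}, ŷ ∈ [−1,1], c ∈ [0,1/2] and η ∈ [0, 1 − 2c]. Let y⋆ ∈ {−1,1} satisfy y⋆·ŷ = |ŷ|, let b = 1 − |ŷ|, and let ℓ(z) = ½(1 − yz) for z ∈ [−1,1]. Then (1 − b)ℓ(y⋆) + c·b + (η/2)(1 − |ŷ|) ≤ ℓ(ŷ). In particular (taking η = 0), (1 − b)ℓ(y⋆) + c·b ≤ ℓ(ŷ) whenever c ≤ 1/2. -/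
/-- Per-round abstention gap bound. `ℓ(z) = (1 − y·z)/2` is the binary prediction loss,
`b = 1 − |ŷ|` the abstention probability and `c` the abstention cost. -/
theorem abstention_gap_per_round (y yhat c η ystar b : ℝ)
    (hy : y = 1 ∨ y = -1) (hyhat : yhat ∈ Set.Icc (-1 : ℝ) 1)
    (hc : c ∈ Set.Icc (0 : ℝ) (1 / 2)) (hη : η ∈ Set.Icc (0 : ℝ) (1 - 2 * c))
    (hystar : (ystar = 1 ∨ ystar = -1) ∧ ystar * yhat = |yhat|)
    (hb : b = 1 - |yhat|) :
    (1 - b) * ((1 - y * ystar) / 2) + c * b + (η / 2) * (1 - |yhat|)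
      ≤ (1 - y * yhat) / 2 := by
  obtain ⟨hs, hab⟩ := hystar
  have h1 : |yhat| ≤ 1 := abs_le.mpr hyhat
  have h2 : |yhat| * ystar = yhat := by
    rw [← hab]
    rcases hs with h | h <;> subst h <;> ring
  have h3 : 0 ≤ (1 - |yhat|) * (1 - 2 * c - η) :=
    mul_nonneg (by linarith) (by linarith [hη.2])
  have h4 : y * (|yhat| * ystar) = y * yhat := by rw [h2]
  subst hb
  linarith
end
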